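/- arXiv:1408.4384 — 4 statements merged into one kernel-verified Lean document; each statement's English description precedes it below -/
import Mathlib

section
/- Let H be a real Hilbert space and T : H → H a bounded self-adjoint positive linear operator. Suppose v ∈ H is a unit vector with T v = μ v for some μ > 0, and there exists κ with 0 ≤ κ < μ such that ‖T w‖ ≤ κ‖w‖ for every w ∈ H orthogonal to v. If x ∈ H satisfies ⟪v, x⟫ > 0, then T^p x ≠ 0 for every p ≥ 0, and the normalized iterates (T^p x)/‖T^p x‖ converge in H to v as p → ∞. -/
open Filter
open scoped RealInnerProductSpace Topology

theorem ContinuousLinearMap.pow_apply_eq_smul_of_apply_eq_smul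
    {H : Type*} [NormedAddCommGroup H] [NormedSpace ℝ H]
    {T : H →L[ℝ] H} {v : H} {μ : ℝ} (hTv : T v = μ • v) (p : ℕ) :
    (T ^ p) v = μ ^ p • v := by
  induction p with
  | zero => simp
  | succ p ih =>
    rw [pow_succ', mul_apply_eq_comp, ih, map_smul, hTv, smul_smul, pow_succ]

theorem ContinuousLinearMap.inner_pow_apply_of_apply_eq_smul
    {H : Type*} [NormedAddCommGroup H] [InnerProductSpace ℝ H] {T : H →L[ℝ] H}
    (hsa : ∀ x y : H, ⟪T x, y⟫ = ⟪x, T y⟫) {v : H} {μ : ℝ} (hTv : T v = μ • v)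
    (p : ℕ) (x : H) : ⟪v, (T ^ p) x⟫ = μ ^ p * ⟪v, x⟫ := by
  induction p with
  | zero => simp
  | succ p ih =>
    rw [pow_succ', mul_apply_eq_comp, ← hsa, hTv, real_inner_smul_left, ih,
      pow_succ', mul_assoc]

/-- A bound for `T` on the orthogonal complement of an eigenvector passes to the powers of `T`. -/
theorem ContinuousLinearMap.norm_pow_apply_le_of_inner_eq_zero
    {H : Type*} [NormedAddCommGroup H] [InnerProductSpace ℝ H] {T : H →L[ℝ] H}
    (hsa : ∀ x y : H, ⟪T x, y⟫ = ⟪x, T y⟫) {v : H} {μ : ℝ} (hTv : T v = μ • v)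
    {κ : ℝ} (hκ0 : 0 ≤ κ) (hgap : ∀ w : H, ⟪v, w⟫ = 0 → ‖T w‖ ≤ κ * ‖w‖)
    {w : H} (hw : ⟪v, w⟫ = 0) (p : ℕ) : ‖(T ^ p) w‖ ≤ κ ^ p * ‖w‖ := by
  induction p with
  | zero => simp
  | succ p ih =>
    have h0 : ⟪v, (T ^ p) w⟫ = 0 := by
      rw [inner_pow_apply_of_apply_eq_smul hsa hTv, hw, mul_zero]
    calc ‖(T ^ (p + 1)) w‖ = ‖T ((T ^ p) w)‖ := by rw [pow_succ', mul_apply_eq_comp]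
      _ ≤ κ * ‖(T ^ p) w‖ := hgap _ h0
      _ ≤ κ * (κ ^ p * ‖w‖) := by gcongr
      _ = κ ^ (p + 1) * ‖w‖ := by ring

/-- Rescaled by powers of the top eigenvalue, the iterates converge to the orthogonal projection
onto the eigenline. -/
theorem ContinuousLinearMap.tendsto_inv_pow_smul_pow_apply
    {H : Type*} [NormedAddCommGroup H] [InnerProductSpace ℝ H] {T : H →L[ℝ] H}
    (hsa : ∀ x y : H, ⟪T x, y⟫ = ⟪x, T y⟫) {v : H} (hv : ‖v‖ = 1)
    {μ : ℝ} (hμ : 0 < μ) (hTv : T v = μ • v) {κ : ℝ} (hκ0 : 0 ≤ κ) (hκμ : κ < μ)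
    (hgap : ∀ w : H, ⟪v, w⟫ = 0 → ‖T w‖ ≤ κ * ‖w‖) (x : H) :
    Tendsto (fun p : ℕ => (μ ^ p)⁻¹ • (T ^ p) x) atTop (𝓝 (⟪v, x⟫ • v)) := by
  set w := x - ⟪v, x⟫ • v with hw_def
  have hw : ⟪v, w⟫ = 0 := by
    rw [hw_def, inner_sub_right, real_inner_smul_right, real_inner_self_eq_norm_sq, hv]
    ring
  have hdiff (p : ℕ) :
      (μ ^ p)⁻¹ • (T ^ p) x - ⟪v, x⟫ • v = (μ ^ p)⁻¹ • (T ^ p) w := by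
    rw [hw_def, map_sub, map_smul, pow_apply_eq_smul_of_apply_eq_smul hTv, smul_sub,
      smul_comm ⟪v, x⟫ (μ ^ p), inv_smul_smul₀ (pow_pos hμ p).ne']
  have hbound (p : ℕ) :
      ‖(μ ^ p)⁻¹ • (T ^ p) x - ⟪v, x⟫ • v‖ ≤ (κ / μ) ^ p * ‖w‖ := by
    rw [hdiff, norm_smul, norm_inv, norm_pow, Real.norm_of_nonneg hμ.le, div_pow, div_eq_inv_mul,
      mul_assoc]
    gcongr
    exact norm_pow_apply_le_of_inner_eq_zero hsa hTv hκ0 hgap hw p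
  rw [tendsto_iff_norm_sub_tendsto_zero]
  refine squeeze_zero (fun _ => norm_nonneg _) hbound ?_
  simpa using (tendsto_pow_atTop_nhds_zero_of_lt_one (div_nonneg hκ0 hμ.le)
    ((div_lt_one hμ).2 hκμ)).mul_const ‖w‖

/-- Power-method convergence of normalized iterates to the top eigenvector,
for a bounded self-adjoint positive operator with a spectral gap, starting from
an ansatz with positive overlap. -/
theorem normalized_power_iterates_tendsto
    {H : Type*} [NormedAddCommGroup H] [InnerProductSpace ℝ H] [CompleteSpace H]
    (T : H →L[ℝ] H)
    (hsa : ∀ x y : H, ⟪T x, y⟫ = ⟪x, T y⟫)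
    (hpos : ∀ x : H, 0 ≤ ⟪x, T x⟫)
    (v : H) (hv : ‖v‖ = 1) (μ : ℝ) (hμ : 0 < μ) (hTv : T v = μ • v)
    (κ : ℝ) (hκ0 : 0 ≤ κ) (hκμ : κ < μ)
    (hgap : ∀ w : H, ⟪v, w⟫ = 0 → ‖T w‖ ≤ κ * ‖w‖)
    (x : H) (hx : 0 < ⟪v, x⟫) :
    (∀ p : ℕ, (T ^ p) x ≠ 0) ∧
      Tendsto (fun p : ℕ => ‖(T ^ p) x‖⁻¹ • (T ^ p) x) atTop (𝓝 v) := by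
  refine ⟨fun p h0 => ?_, ?_⟩
  · have h := T.inner_pow_apply_of_apply_eq_smul hsa hTv p x
    rw [h0, inner_zero_right] at h
    exact (mul_pos (pow_pos hμ p) hx).ne h
  · have hlim := T.tendsto_inv_pow_smul_pow_apply hsa hv hμ hTv hκ0 hκμ hgap x
    have hnorm : ‖⟪v, x⟫ • v‖ = ⟪v, x⟫ := by
      rw [norm_smul, hv, mul_one, Real.norm_of_nonneg hx.le]
    have h := (hlim.norm.inv₀ (by rw [hnorm]; exact hx.ne')).smul hlim
    rw [hnorm, inv_smul_smul₀ hx.ne'] at h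
    refine h.congr fun p => ?_
    have hp : 0 < μ ^ p := pow_pos hμ p
    rw [norm_smul, norm_inv, Real.norm_of_nonneg hp.le, mul_inv, inv_inv, smul_smul,
      mul_right_comm, mul_inv_cancel₀ hp.ne', one_mul]
end

section
/- Let H be a real Hilbert space and T : H → H a bounded self-adjoint positive linear operator, and let x ∈ H be such that T^p x ≠ 0 for every p ≥ 0. Then the sequence of Rayleigh quotients r_p := ⟪T^p x, T^{p+1} x⟫ / ‖T^p x‖² is monotone nondecreasing in p (equivalently, the corresponding energy estimates E_p = 1/r_p of the paper form a monotonically decreasing sequence). -/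
open scoped RealInnerProductSpace

/-- Applying a symmetric positive operator does not decrease the Rayleigh quotient. -/
theorem rayleigh_quotient_le_rayleigh_quotient_apply
    {H : Type*} [NormedAddCommGroup H] [InnerProductSpace ℝ H] (T : H →L[ℝ] H)
    (hsa : ∀ x y : H, ⟪T x, y⟫ = ⟪x, T y⟫) (hpos : ∀ x : H, 0 ≤ ⟪x, T x⟫)
    {u : H} (hTu : T u ≠ 0) :
    ⟪u, T u⟫ / ‖u‖ ^ 2 ≤ ⟪T u, T (T u)⟫ / ‖T u‖ ^ 2 := by
  have hu : u ≠ 0 := by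
    rintro rfl
    exact hTu (map_zero T)
  have ha : 0 < ‖u‖ ^ 2 := by positivity
  have hc : 0 < ‖T u‖ ^ 2 := by positivity
  have hb := hpos u
  have hd := hpos (T u)
  have hcs : ⟪u, T u⟫ ^ 2 ≤ ‖u‖ ^ 2 * ‖T u‖ ^ 2 := by
    rw [← mul_pow]
    exact pow_le_pow_left₀ hb (real_inner_le_norm u (T u)) 2
  have hq := hpos ((‖T u‖ ^ 2) • u - ⟪u, T u⟫ • T u)
  have huTT : ⟪u, T (T u)⟫ = ‖T u‖ ^ 2 := by
    rw [← hsa, real_inner_self_eq_norm_sq]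
  simp only [map_sub, map_smul, inner_sub_left, inner_sub_right, real_inner_smul_left,
    real_inner_smul_right, huTT, real_inner_self_eq_norm_sq] at hq
  rw [div_le_div_iff₀ ha hc]
  generalize ‖u‖ ^ 2 = a at *
  generalize ‖T u‖ ^ 2 = c at *
  generalize ⟪u, T u⟫ = b at *
  generalize ⟪T u, T (T u)⟫ = d at *
  refine le_of_mul_le_mul_right ?_ hc
  calc b * c * c ≤ b ^ 2 * d := by linarith
    _ ≤ a * c * d := mul_le_mul_of_nonneg_right hcs hd
    _ = d * a * c := by ring

/-- The Rayleigh quotients of the power-method iterates of a bounded self-adjoint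
positive operator form a monotone nondecreasing sequence. -/
theorem rayleigh_quotients_of_iterates_monotone
    {H : Type*} [NormedAddCommGroup H] [InnerProductSpace ℝ H] [CompleteSpace H]
    (T : H →L[ℝ] H)
    (hsa : ∀ x y : H, ⟪T x, y⟫ = ⟪x, T y⟫)
    (hpos : ∀ x : H, 0 ≤ ⟪x, T x⟫)
    (x : H) (hx : ∀ p : ℕ, (T ^ p) x ≠ 0) :
    Monotone (fun p : ℕ => ⟪(T ^ p) x, (T ^ (p + 1)) x⟫ / ‖(T ^ p) x‖ ^ 2) := by
  refine monotone_nat_of_le_succ fun p => ?_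
  simp only [pow_succ' T, ContinuousLinearMap.mul_def, ContinuousLinearMap.comp_apply]
  refine rayleigh_quotient_le_rayleigh_quotient_apply T hsa hpos ?_
  simpa only [pow_succ' T, ContinuousLinearMap.mul_def, ContinuousLinearMap.comp_apply]
    using hx (p + 1)
end

section
/- Let H be a real Hilbert space and T : H → H a bounded self-adjoint positive linear operator. Suppose v₀ ∈ H is a unit vector with T v₀ = μ₀ v₀ for some μ₀ ≥ 0, and v₁ ∈ H is a unit vector orthogonal to v₀ with T v₁ = μ₁ v₁ for some μ₁ > 0, and there exists κ with 0 ≤ κ < μ₁ such that ‖T w‖ ≤ κ‖w‖ for every w ∈ H orthogonal to both v₀ and v₁. Given x ∈ H, define recursively y₀ = x and y_{p+1} = T y_p − ⟪v₀, T y_p⟫ v₀ (apply T, then orthogonalize against v₀). Then μ₁^{−p} y_p converges in H, as p → ∞, to ⟪v₁, x⟫ v₁. -/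
open Filter
open scoped RealInnerProductSpace Topology

/-- Power method with orthogonalization against a known eigenvector `v₀` (the zero
mode image): the rescaled orthogonalized iterates converge to the component along
the next eigenvector `v₁`. -/
theorem deflated_power_iterates_tendsto
    {H : Type*} [NormedAddCommGroup H] [InnerProductSpace ℝ H] [CompleteSpace H]
    (T : H →L[ℝ] H)
    (hsa : ∀ x y : H, ⟪T x, y⟫ = ⟪x, T y⟫)
    (hpos : ∀ x : H, 0 ≤ ⟪x, T x⟫)
    (v₀ : H) (hv₀ : ‖v₀‖ = 1) (μ₀ : ℝ) (hμ₀ : 0 ≤ μ₀) (hTv₀ : T v₀ = μ₀ • v₀)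
    (v₁ : H) (hv₁ : ‖v₁‖ = 1) (hperp : ⟪v₀, v₁⟫ = 0)
    (μ₁ : ℝ) (hμ₁ : 0 < μ₁) (hTv₁ : T v₁ = μ₁ • v₁)
    (κ : ℝ) (hκ0 : 0 ≤ κ) (hκμ : κ < μ₁)
    (hgap : ∀ w : H, ⟪v₀, w⟫ = 0 → ⟪v₁, w⟫ = 0 → ‖T w‖ ≤ κ * ‖w‖)
    (x : H) (y : ℕ → H) (hy0 : y 0 = x)
    (hy : ∀ p : ℕ, y (p + 1) = T (y p) - ⟪v₀, T (y p)⟫ • v₀) :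
    Tendsto (fun p : ℕ => (μ₁ ^ p)⁻¹ • y p) atTop (𝓝 (⟪v₁, x⟫ • v₁)) := by
  have hT₀ (w : H) : ⟪v₀, T w⟫ = μ₀ * ⟪v₀, w⟫ := by
    rw [← hsa, hTv₀, real_inner_smul_left]
  have hT₁ (w : H) : ⟪v₁, T w⟫ = μ₁ * ⟪v₁, w⟫ := by
    rw [← hsa, hTv₁, real_inner_smul_left]
  have hperp' : ⟪v₁, v₀⟫ = 0 := by rw [real_inner_comm, hperp]
  have hy₀ (p : ℕ) : ⟪v₀, y (p + 1)⟫ = 0 := by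
    rw [hy, inner_sub_right, real_inner_smul_right, real_inner_self_eq_norm_sq, hv₀]
    ring
  have hy₁ (p : ℕ) : ⟪v₁, y p⟫ = μ₁ ^ p * ⟪v₁, x⟫ := by
    induction p with
    | zero => simp [hy0]
    | succ p ih =>
      rw [hy, inner_sub_right, real_inner_smul_right, hperp', hT₁, ih]
      ring
  set c := ⟪v₁, x⟫
  have hbound (p : ℕ) :
      ‖y (p + 1) - (μ₁ ^ (p + 1) * c) • v₁‖ ≤ κ ^ p * ‖y 1 - (μ₁ * c) • v₁‖ := by
    induction p with
    | zero => simp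
    | succ p ih =>
      have hstep : y (p + 2) - (μ₁ ^ (p + 2) * c) • v₁
          = T (y (p + 1) - (μ₁ ^ (p + 1) * c) • v₁) := by
        rw [hy (p + 1), hT₀, hy₀, map_sub, map_smul, hTv₁]
        module
      rw [hstep]
      refine (hgap _ ?_ ?_).trans ?_
      · rw [inner_sub_right, real_inner_smul_right, hy₀, hperp]
        ring
      · rw [inner_sub_right, real_inner_smul_right, hy₁, real_inner_self_eq_norm_sq, hv₁]
        ring
      · rw [pow_succ' κ, mul_assoc κ]
        gcongr
  rw [← tendsto_add_atTop_iff_nat 1, tendsto_iff_norm_sub_tendsto_zero]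
  have hlim : Tendsto (fun p : ℕ => (κ / μ₁) ^ p * (‖y 1 - (μ₁ * c) • v₁‖ / μ₁))
      atTop (𝓝 0) := by
    simpa using (tendsto_pow_atTop_nhds_zero_of_lt_one (by positivity)
      ((div_lt_one hμ₁).2 hκμ)).mul_const (‖y 1 - (μ₁ * c) • v₁‖ / μ₁)
  refine squeeze_zero (fun _ => norm_nonneg _) (fun p => ?_) hlim
  have hscale : (μ₁ ^ (p + 1))⁻¹ • y (p + 1) - c • v₁
      = (μ₁ ^ (p + 1))⁻¹ • (y (p + 1) - (μ₁ ^ (p + 1) * c) • v₁) := by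
    rw [smul_sub, smul_smul, inv_mul_cancel_left₀ (by positivity)]
  rw [hscale, norm_smul, Real.norm_of_nonneg (by positivity)]
  calc (μ₁ ^ (p + 1))⁻¹ * ‖y (p + 1) - (μ₁ ^ (p + 1) * c) • v₁‖
      ≤ (μ₁ ^ (p + 1))⁻¹ * (κ ^ p * ‖y 1 - (μ₁ * c) • v₁‖) := by
        gcongr
        exact hbound p
    _ = (κ / μ₁) ^ p * (‖y 1 - (μ₁ * c) • v₁‖ / μ₁) := by
        rw [div_pow, pow_succ]
        field_simp
end

section
/- Let H be a real Hilbert space, T : H → H a bounded self-adjoint linear operator, and ξ ∈ H a unit vector with η := ⟪ξ, T ξ⟫ and T ξ ≠ η ξ. Set υ := ‖T ξ − η ξ‖, χ := υ⁻¹(T ξ − η ξ), ε := ⟪χ, T χ⟫, Δ := √((η − ε)² + 4υ²), and V₂ := (1/√2)(√((η − ε + Δ)/Δ) ξ + √((ε − η + Δ)/Δ) χ). Then ‖V₂‖ = 1 and ⟪V₂, T V₂⟫ = (η + ε + Δ)/2 ≥ η; that is, each step of the iteration does not decrease the Rayleigh quotient. -/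
open scoped RealInnerProductSpace

/-- A two-dimensional combination `c • (a • ξ + b • χ)` of orthogonal unit vectors has squared
norm `c ^ 2 * (a ^ 2 + b ^ 2)`. -/
theorem norm_sq_smul_add_smul_of_inner_eq_zero
    {H : Type*} [NormedAddCommGroup H] [InnerProductSpace ℝ H] {ξ χ : H}
    (hξ : ‖ξ‖ = 1) (hχ : ‖χ‖ = 1) (h : ⟪ξ, χ⟫ = 0) (a b c : ℝ) :
    ‖c • (a • ξ + b • χ)‖ ^ 2 = c ^ 2 * (a ^ 2 + b ^ 2) := by
  rw [← real_inner_self_eq_norm_sq]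
  simp only [inner_smul_left, inner_smul_right, inner_add_left, inner_add_right,
    real_inner_self_eq_norm_sq, hξ, hχ, h, real_inner_comm ξ χ, conj_trivial]
  ring

/-- The quadratic form of a symmetric operator on a two-dimensional combination of vectors. -/
theorem inner_map_smul_add_smul_of_symm
    {H : Type*} [NormedAddCommGroup H] [InnerProductSpace ℝ H] (T : H →L[ℝ] H)
    (hsa : ∀ x y : H, ⟪T x, y⟫ = ⟪x, T y⟫) (ξ χ : H) (a b c : ℝ) :
    ⟪c • (a • ξ + b • χ), T (c • (a • ξ + b • χ))⟫ =
      c ^ 2 * (a ^ 2 * ⟪ξ, T ξ⟫ + 2 * (a * b) * ⟪χ, T ξ⟫ + b ^ 2 * ⟪χ, T χ⟫) := by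
  have h : ⟪ξ, T χ⟫ = ⟪χ, T ξ⟫ := by rw [← hsa, real_inner_comm]
  simp only [map_smul, map_add, inner_smul_left, inner_smul_right, inner_add_left,
    inner_add_right, h, conj_trivial]
  ring

/-- One step of the Lanczos-type iteration: the new vector `V₂` is a unit vector
whose Rayleigh quotient `(η + ε + Δ)/2` is at least the previous one `η`. -/
theorem lanczos_step_increases_rayleigh_quotient
    {H : Type*} [NormedAddCommGroup H] [InnerProductSpace ℝ H] [CompleteSpace H]
    (T : H →L[ℝ] H)
    (hsa : ∀ x y : H, ⟪T x, y⟫ = ⟪x, T y⟫)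
    (ξ : H) (hξ : ‖ξ‖ = 1)
    (η : ℝ) (hη : η = ⟪ξ, T ξ⟫) (hne : T ξ ≠ η • ξ)
    (υ : ℝ) (hυ : υ = ‖T ξ - η • ξ‖)
    (χ : H) (hχ : χ = υ⁻¹ • (T ξ - η • ξ))
    (ε : ℝ) (hε : ε = ⟪χ, T χ⟫)
    (Δ : ℝ) (hΔ : Δ = Real.sqrt ((η - ε) ^ 2 + 4 * υ ^ 2))
    (V₂ : H)
    (hV₂ : V₂ = (Real.sqrt 2)⁻¹ •
      (Real.sqrt ((η - ε + Δ) / Δ) • ξ + Real.sqrt ((ε - η + Δ) / Δ) • χ)) :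
    ‖V₂‖ = 1 ∧ ⟪V₂, T V₂⟫ = (η + ε + Δ) / 2 ∧ η ≤ (η + ε + Δ) / 2 := by
  have hυ_pos : 0 < υ := by
    rw [hυ]
    exact norm_pos_iff.mpr (sub_ne_zero.mpr hne)
  have hTξ : T ξ = η • ξ + υ • χ := by
    rw [hχ, smul_inv_smul₀ hυ_pos.ne']
    abel
  have hχ_norm : ‖χ‖ = 1 := by
    rw [hχ, norm_smul, ← hυ, norm_inv, Real.norm_of_nonneg hυ_pos.le,
      inv_mul_cancel₀ hυ_pos.ne']
  have h_orth : ⟪ξ, χ⟫ = 0 := by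
    rw [hχ, inner_smul_right, inner_sub_right, inner_smul_right,
      real_inner_self_eq_norm_sq, hξ, ← hη]
    ring
  have hχTξ : ⟪χ, T ξ⟫ = υ := by
    rw [hTξ, inner_add_right, inner_smul_right, inner_smul_right, real_inner_comm,
      h_orth, real_inner_self_eq_norm_sq, hχ_norm]
    ring
  have hΔ_sq : Δ ^ 2 = (η - ε) ^ 2 + 4 * υ ^ 2 := by
    rw [hΔ, Real.sq_sqrt (by positivity)]
  have hΔ_pos : 0 < Δ := by
    rw [hΔ]
    positivity
  have h_abs : |η - ε| ≤ Δ := abs_le_of_sq_le_sq (by nlinarith) hΔ_pos.le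
  obtain ⟨h_lower, h_upper⟩ := abs_le.mp h_abs
  have ha_nonneg : 0 ≤ (η - ε + Δ) / Δ := div_nonneg (by linarith) hΔ_pos.le
  have hb_nonneg : 0 ≤ (ε - η + Δ) / Δ := div_nonneg (by linarith) hΔ_pos.le
  have hab : √((η - ε + Δ) / Δ) * √((ε - η + Δ) / Δ) = 2 * υ / Δ := by
    rw [← Real.sqrt_mul ha_nonneg, Real.sqrt_eq_iff_mul_self_eq
      (mul_nonneg ha_nonneg hb_nonneg) (by positivity)]
    field_simp
    linear_combination hΔ_sq
  have hc : (√2)⁻¹ ^ 2 = (1 / 2 : ℝ) := by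
    rw [inv_pow, Real.sq_sqrt (by norm_num)]
    norm_num
  refine ⟨?_, ?_, by linarith⟩
  · have h_sq : ‖V₂‖ ^ 2 = 1 := by
      rw [hV₂, norm_sq_smul_add_smul_of_inner_eq_zero hξ hχ_norm h_orth, hc,
        Real.sq_sqrt ha_nonneg, Real.sq_sqrt hb_nonneg]
      field_simp
      ring
    exact (pow_eq_one_iff_of_nonneg (norm_nonneg V₂) two_ne_zero).mp h_sq
  · rw [hV₂, inner_map_smul_add_smul_of_symm T hsa, hc, Real.sq_sqrt ha_nonneg,
      Real.sq_sqrt hb_nonneg, hab, hχTξ, ← hη, ← hε]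
    field_simp
    linear_combination -hΔ_sq
end
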